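/- Virial relation for binary neutron stars in IWM spacetimes and equality M_χ = M_ADM (Eq. virial): assume (i) the Hamiltonian constraint Δψ = −2π ψ⁵ ρ_H − (ψ⁵/8) K̂_i^j K̂_j^i, the slicing equation Δχ = 2π χ ψ⁴ (ρ_H + 2S) + (7/8) χ ψ⁴ K̂_i^j K̂_j^i with S := j_k (v^k + β^k)/α + 3P, and the momentum constraint ∂_j(ψ⁶ K̂_i^j) = 8π j_i ψ⁶, with ρ_H, j, P, v smooth and compactly supported; (ii) the helically symmetric Euler equation: for each k, −Ω [ ∂_l(φ_b^l ψ⁶ j_k) + ψ⁶ j_l ∂_k φ_b^l ] + ∂_j(ψ⁶ j_k v^j) + ∂_k(α ψ⁶ P) + ρ_H ψ⁵ ∂_k χ − (ρ_H + 2S) χ ψ⁴ ∂_k ψ − ψ⁶ j_l ∂_k β^l = 0, where φ_b(x) = (−x₂, x₁ − b, 0); (iii) vanishing ADM 3-momentum: for each i the flux of ψ⁶ K̂_i^j (index j) vanishes at infinity; (iv) the fluxes at infinity of ψ⁶ K̂_i^j β^i, ψ⁶ K̂_i^j x^k ∂_k β^i, ψ⁶ K̂_i^k x^j ∂_j β^i,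 α ψ⁶ K̂_i^j K̂_j^i x^k, and (x·∇ψ)∇χ + (x·∇χ)∇ψ − (∇ψ·∇χ) x all vanish, the flux limits M_χ := (1/2π) lim ∮_{S_r} ψ (∇χ·n) dA and M_ADM := −(1/2π) lim ∮_{S_r} χ (∇ψ·n) dA exist, and all displayed integrands are integrable. Then ∫ [ ψ⁶ j_k v^k + 3 α ψ⁶ P + (1/2π) ∇χ·∇ψ − (1/2) ψ⁶ j_k β^k ] dV = 0, and consequently M_χ = M_ADM. -/

import Mathlib

noncomputable section
open MeasureTheory Filter Topology Real

abbrev E3 := EuclideanSpace ℝ (Fin 3)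

/-- Partial derivative in the `i`-th coordinate direction. -/
noncomputable def pd (i : Fin 3) (f : E3 → ℝ) (x : E3) : ℝ :=
  fderiv ℝ f x (EuclideanSpace.single i 1)

/-- Flat Laplacian on `ℝ³`. -/
noncomputable def lap (f : E3 → ℝ) (x : E3) : ℝ := ∑ i, pd i (fun y => pd i f y) x

/-- Surface integral over the sphere of radius `r` (centered at the origin) of the outward
normal component of the vector field with components `F · i`. -/
noncomputable def flux (F : E3 → Fin 3 → ℝ) (r : ℝ) : ℝ :=
  r ^ 2 * ∫ ω : Metric.sphere (0 : E3) 1,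
      (∑ i, F (r • (ω : E3)) i * (ω : E3) i) ∂((volume : Measure E3).toSphere)

/-- Tracefree extrinsic curvature `K̂_i^j` built from lapse `a` and shift `β`. -/
noncomputable def Khat (a : E3 → ℝ) (β : E3 → Fin 3 → ℝ) (i j : Fin 3) (x : E3) : ℝ :=
  (1 / (2 * a x)) *
    (pd i (fun y => β y j) x + pd j (fun y => β y i) x
      - (2 / 3) * (if i = j then (1 : ℝ) else 0) * ∑ k, pd k (fun y => β y k) x)

/-- Double contraction `K̂_i^j K̂_j^i`. -/
noncomputable def KK (a : E3 → ℝ) (β : E3 → Fin 3 → ℝ) (x : E3) : ℝ :=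
  ∑ i, ∑ j, Khat a β i j x * Khat a β j i x
/-- `χ := αψ`. -/
noncomputable def chi (α ψ : E3 → ℝ) (x : E3) : ℝ := α x * ψ x

/-- The rotational vector field `φ_b(x) = (−x₂, x₁ − b, 0)`. -/
noncomputable def phib (b : ℝ) (x : E3) : Fin 3 → ℝ := ![-(x 1), x 0 - b, 0]

lemma polar_integral (G : E3 → ℝ) (hG : Integrable G) :
    ∫ x, G x = ∫ r in Set.Ioi (0:ℝ), r ^ 2 *
      ∫ ω : Metric.sphere (0 : E3) 1, G (r • (ω : E3)) ∂((volume : Measure E3).toSphere) := by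
  have mp := (volume : Measure E3).measurePreserving_homeomorphUnitSphereProd
  have hd : Module.finrank ℝ E3 - 1 = 2 := by simp
  rw [hd] at mp
  let g : (Metric.sphere (0 : E3) 1) × (Set.Ioi (0:ℝ)) → ℝ := fun p => G ((p.2 : ℝ) • (p.1 : E3))
  have hcomp : ∀ x : ({0}ᶜ : Set E3), g (homeomorphUnitSphereProd E3 x) = G x := by
    intro x
    have := congrArg Subtype.val ((homeomorphUnitSphereProd E3).symm_apply_apply x)
    rw [homeomorphUnitSphereProd_symm_apply_coe] at this
    simp only [g, this]
  have h1 : ∫ x, G x = ∫ x : ({0}ᶜ : Set E3), G x ∂((volume : Measure E3).comap (↑)) := by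
    rw [integral_subtype_comap (measurableSet_singleton _).compl G, restrict_compl_singleton]
  have h2 : ∫ x : ({0}ᶜ : Set E3), G x ∂((volume : Measure E3).comap (↑))
      = ∫ p, g p ∂((volume : Measure E3).toSphere.prod (Measure.volumeIoiPow 2)) := by
    rw [← mp.integral_comp (Homeomorph.measurableEmbedding _) g]
    simp only [hcomp]
  have hgint : Integrable g ((volume : Measure E3).toSphere.prod (Measure.volumeIoiPow 2)) := by
    rw [← mp.integrable_comp_emb (Homeomorph.measurableEmbedding _)]
    have : g ∘ (homeomorphUnitSphereProd E3) = G ∘ Subtype.val := funext hcomp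
    rw [this, ← integrableOn_iff_comap_subtypeVal (measurableSet_singleton _).compl,
      IntegrableOn, restrict_compl_singleton]
    exact hG
  rw [h1, h2, integral_prod_symm _ hgint]
  simp only [Measure.volumeIoiPow, ENNReal.ofReal]
  rw [integral_withDensity_eq_integral_smul
      ((measurable_subtype_coe.pow_const _).real_toNNReal),
    integral_subtype_comap measurableSet_Ioi fun a => Real.toNNReal (a ^ 2) •
      ∫ ω : Metric.sphere (0 : E3) 1, G (a • (ω : E3)) ∂((volume : Measure E3).toSphere)]
  refine setIntegral_congr_fun measurableSet_Ioi fun x hx => ?_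
  simp only [NNReal.smul_def, Real.coe_toNNReal _ (pow_nonneg (le_of_lt (Set.mem_Ioi.1 hx)) 2),
    smul_eq_mul]

/-- radial cutoff profile -/
noncomputable def hcut (t : ℝ) : ℝ := Real.smoothTransition (2 - t)

lemma hcut_contDiff : ContDiff ℝ (⊤ : ℕ∞) hcut :=
  Real.smoothTransition.contDiff.comp (contDiff_const.sub contDiff_id)

lemma hcut_deriv_cont : Continuous (deriv hcut) :=
  hcut_contDiff.continuous_deriv (by simp)

lemma hcut_diff : Differentiable ℝ hcut := hcut_contDiff.differentiable (by simp)

lemma hcut_deriv_lt {t : ℝ} (ht : t < 1) : deriv hcut t = 0 := by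
  have : hcut =ᶠ[𝓝 t] fun _ => (1:ℝ) := by
    filter_upwards [Iio_mem_nhds ht] with y hy
    exact Real.smoothTransition.one_of_one_le (by linarith [Set.mem_Iio.1 hy])
  rw [this.deriv_eq]; simp

lemma hcut_deriv_gt {t : ℝ} (ht : 2 < t) : deriv hcut t = 0 := by
  have : hcut =ᶠ[𝓝 t] fun _ => (0:ℝ) := by
    filter_upwards [Ioi_mem_nhds ht] with y hy
    exact Real.smoothTransition.zero_of_nonpos (by linarith [Set.mem_Ioi.1 hy])
  rw [this.deriv_eq]; simp

lemma hcut_zero {t : ℝ} (ht : 2 ≤ t) : hcut t = 0 :=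
    Real.smoothTransition.zero_of_nonpos (by linarith)

lemma hcut_one {t : ℝ} (ht : t ≤ 1) : hcut t = 1 :=
    Real.smoothTransition.one_of_one_le (by linarith)

lemma hcut_abs (t : ℝ) : |hcut t| ≤ 1 := by
  rw [abs_le]; constructor
  · linarith [Real.smoothTransition.nonneg (2 - t), show hcut t = Real.smoothTransition (2-t) from rfl]
  · exact Real.smoothTransition.le_one _

noncomputable def wcut (s : ℝ) : ℝ := -(deriv hcut (s ^ 2) * (2 * s))

lemma wcut_cont : Continuous wcut := by
  have := hcut_deriv_cont
  unfold wcut; fun_prop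

lemma wcut_int : Integrable wcut := by
  apply wcut_cont.integrable_of_hasCompactSupport
  apply HasCompactSupport.intro (isCompact_Icc (a := (-2:ℝ)) (b := 2))
  intro x hx
  have : 2 < x ^ 2 := by
    by_contra h
    exact hx ⟨by nlinarith, by nlinarith⟩
  simp [wcut, hcut_deriv_gt this]

lemma wcut_integral : ∫ s in Set.Ioi (0:ℝ), wcut s = 1 := by
  have := integral_Ioi_of_hasDerivAt_of_tendsto' (a := (0:ℝ)) (f := fun s => - hcut (s^2)) (f' := wcut)
    (m := 0) ?_ wcut_int.integrableOn ?_
  · rw [this]; simp [hcut_one]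
  · intro x _
    have h1 : HasDerivAt (fun s : ℝ => s ^ 2) (2 * x) x := by
      simpa using hasDerivAt_pow 2 x
    exact ((hcut_diff (x^2)).hasDerivAt.comp x h1).neg
  · apply tendsto_const_nhds.congr'
    filter_upwards [eventually_ge_atTop 2] with s hs
    rw [hcut_zero (by nlinarith)]; simp

lemma flux_cont (F : E3 → Fin 3 → ℝ) (hF : ∀ i, Continuous fun x => F x i) :
    Continuous (flux F) := by
  unfold flux
  refine (continuous_pow 2).mul ?_
  have := continuous_parametric_integral_of_continuous (μ := (volume : Measure E3).toSphere)
    (f := fun (r : ℝ) (ω : Metric.sphere (0 : E3) 1) => ∑ i, F (r • (ω : E3)) i * (ω : E3) i)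
    (s := Set.univ) ?_ isCompact_univ
  · simpa using this
  · refine continuous_finsetSum _ fun i _ => ?_
    refine ((hF i).comp ?_).mul ?_ <;> fun_prop

lemma flux_weighted (F : E3 → Fin 3 → ℝ) (hF : ∀ i, Continuous fun x => F x i) (L : ℝ)
    (hfl : Tendsto (flux F) atTop (𝓝 L)) :
    Tendsto (fun n : ℝ => ∫ s in Set.Ioi (0:ℝ), wcut s * flux F (n * s)) atTop (𝓝 L) := by
  have hL : ∫ s in Set.Ioi (0:ℝ), wcut s * L = L := by
    rw [integral_mul_const, wcut_integral, one_mul]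
  have hc := flux_cont F hF
  have hw := wcut_cont
  rw [show 𝓝 L = 𝓝 (∫ s in Set.Ioi (0:ℝ), wcut s * L) by rw [hL]]
  refine tendsto_integral_filter_of_dominated_convergence (fun s => |wcut s| * (|L| + 1)) ?_ ?_ ?_ ?_
  · refine Eventually.of_forall fun n => Continuous.aestronglyMeasurable ?_
    fun_prop
  · have hb : ∀ᶠ r in atTop, |flux F r| ≤ |L| + 1 := by
      have := (hfl.abs).eventually (Iio_mem_nhds (show |L| < |L| + 1 by linarith))
      filter_upwards [this] with r hr using le_of_lt hr
    obtain ⟨N, hN⟩ := eventually_atTop.1 hb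
    filter_upwards [eventually_ge_atTop N, eventually_ge_atTop 0] with n hn hn0
    filter_upwards [ae_restrict_mem measurableSet_Ioi] with s hs
    rw [norm_mul, Real.norm_eq_abs, Real.norm_eq_abs]
    by_cases h1 : s < 1
    · have hs' : 0 < s := hs
      have : wcut s = 0 := by
        rw [wcut, hcut_deriv_lt (by nlinarith)]; simp
      simp [this]
    · refine mul_le_mul_of_nonneg_left (hN _ ?_) (abs_nonneg _)
      nlinarith
  · exact (wcut_int.abs.mul_const _).integrableOn
  · filter_upwards [ae_restrict_mem measurableSet_Ioi] with s hs
    exact (hfl.comp (tendsto_id.atTop_mul_const hs)).const_mul _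

lemma pd_cont {f : E3 → ℝ} (hf : ContDiff ℝ (⊤ : ℕ∞) f) (i : Fin 3) : Continuous (pd i f) := by
  have := hf.continuous_fderiv (by simp)
  unfold pd; fun_prop

/-- cutoff -/
noncomputable def ecut (n : ℝ) (x : E3) : ℝ := hcut (‖x‖ ^ 2 * (n⁻¹) ^ 2)

lemma ecut_contDiff (n : ℝ) : ContDiff ℝ (⊤ : ℕ∞) (ecut n) :=
  hcut_contDiff.comp ((contDiff_norm_sq ℝ).mul contDiff_const)

lemma ecut_supp {n : ℝ} (hn : 0 < n) : HasCompactSupport (ecut n) := by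
  apply HasCompactSupport.intro (isCompact_closedBall (0:E3) (2 * n))
  intro x hx
  have hx' : 2 * n < ‖x‖ := by simpa using hx
  apply hcut_zero
  rw [← mul_pow]
  have : 2 ≤ ‖x‖ * n⁻¹ := by
    rw [← div_eq_mul_inv, le_div_iff₀ hn]; exact hx'.le
  nlinarith

lemma ecut_pd (n : ℝ) (i : Fin 3) (x : E3) :
    pd i (ecut n) x = deriv hcut (‖x‖ ^ 2 * (n⁻¹) ^ 2) * (2 * x i * (n⁻¹)^2) := by
  have h1 : HasFDerivAt (fun x : E3 => ‖x‖ ^ 2 * (n⁻¹) ^ 2) ((n⁻¹ ^ 2) • (2 • (innerSL ℝ x))) x :=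
    (hasStrictFDerivAt_norm_sq x).hasFDerivAt.mul_const _
  have h2 := (hcut_diff (‖x‖ ^ 2 * (n⁻¹) ^ 2)).hasDerivAt.comp_hasFDerivAt x h1
  have h3 : fderiv ℝ (ecut n) x = _ := h2.fderiv
  rw [pd, h3]
  simp [EuclideanSpace.inner_single_right]
  left; ring

lemma cut_parts (F : E3 → Fin 3 → ℝ) (hF : ∀ i, ContDiff ℝ (⊤ : ℕ∞) fun x => F x i)
    {n : ℝ} (hn : 0 < n) :
    ∫ x, ecut n x * ∑ l, pd l (fun y => F y l) x
      = ∫ s in Set.Ioi (0:ℝ), wcut s * flux F (n * s) := by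
  have he := (ecut_contDiff n)
  have hes := ecut_supp hn
  have i1 : ∀ l, Integrable (fun x => pd l (ecut n) x * F x l) := fun l =>
    ((pd_cont he l).mul (hF l).continuous).integrable_of_hasCompactSupport
      ((hes.fderiv_apply ℝ _).mul_right)
  have i2 : ∀ l, Integrable (fun x => ecut n x * pd l (fun y => F y l) x) := fun l =>
    (he.continuous.mul (pd_cont (hF l) l)).integrable_of_hasCompactSupport hes.mul_right
  have i3 : ∀ l, Integrable (fun x => ecut n x * F x l) := fun l =>
    (he.continuous.mul (hF l).continuous).integrable_of_hasCompactSupport hes.mul_right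
  have key : ∀ l, ∫ x, ecut n x * pd l (fun y => F y l) x = - ∫ x, pd l (ecut n) x * F x l := fun l =>
    integral_mul_fderiv_eq_neg_fderiv_mul_of_integrable (i1 l) (i2 l) (i3 l)
      (fun x _ => (he.differentiable (by simp)) x) (fun x _ => ((hF l).differentiable (by simp)) x)
  simp only [Finset.mul_sum]
  rw [integral_finsetSum _ (fun l _ => i2 l)]
  simp only [key]
  rw [Finset.sum_neg_distrib, ← integral_finsetSum _ (fun l _ => i1 l), 
    polar_integral _ (integrable_finsetSum _ (fun l _ => i1 l))]
  have hr : ∀ r ∈ Set.Ioi (0:ℝ), (r ^ 2 * ∫ ω : Metric.sphere (0 : E3) 1, 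
      ∑ l, pd l (ecut n) (r • (ω : E3)) * F (r • (ω : E3)) l ∂((volume : Measure E3).toSphere))
      = - (n⁻¹ * (wcut (r * n⁻¹) * flux F r)) := by
    intro r hr
    have hr' : 0 < r := hr
    have : ∀ ω : Metric.sphere (0 : E3) 1, ∑ l, pd l (ecut n) (r • (ω : E3)) * F (r • (ω : E3)) l
       = (deriv hcut (r^2 * n⁻¹^2) * (2 * r * n⁻¹^2)) * ∑ l,  F (r • (ω : E3)) l * (ω : E3) l := by
      intro ω
      have hω : ‖(ω : E3)‖ = 1 := by simpa using ω.2
      simp only [ecut_pd, norm_smul, hω, Finset.mul_sum, Real.norm_eq_abs, mul_one, sq_abs,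
        PiLp.smul_apply, smul_eq_mul]
      refine Finset.sum_congr rfl fun l _ => by ring
    simp only [this]
    rw [integral_const_mul, flux, wcut, mul_pow]
    ring
  rw [setIntegral_congr_fun measurableSet_Ioi hr, integral_neg, neg_neg]
  have := integral_comp_mul_left_Ioi' (fun r => n⁻¹ * (wcut (r * n⁻¹) * flux F r)) 0 hn
  rw [mul_zero] at this
  rw [← this, smul_eq_mul, ← integral_const_mul]
  refine setIntegral_congr_fun measurableSet_Ioi fun s _ => ?_
  have : n * s * n⁻¹ = s := by field_simp
  simp only [this]
  field_simp

/-- Divergence theorem on all of space. -/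
theorem div_thm (F : E3 → Fin 3 → ℝ) (hF : ∀ i, ContDiff ℝ (⊤ : ℕ∞) fun x => F x i) (L : ℝ)
    (hfl : Tendsto (flux F) atTop (𝓝 L))
    (hint : Integrable fun x => ∑ l, pd l (fun y => F y l) x) :
    ∫ x, ∑ l, pd l (fun y => F y l) x = L := by
  have h1 := flux_weighted F (fun i => (hF i).continuous) L hfl
  have h2 : Tendsto (fun n : ℝ => ∫ x, ecut n x * ∑ l, pd l (fun y => F y l) x) atTop
      (𝓝 (∫ x, ∑ l, pd l (fun y => F y l) x)) := by
    refine tendsto_integral_filter_of_dominated_convergence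
      (fun x => |∑ l, pd l (fun y => F y l) x|) ?_ ?_ hint.abs ?_
    · exact Eventually.of_forall fun n =>
        (ecut_contDiff n).continuous.aestronglyMeasurable.mul hint.aestronglyMeasurable
    · refine Eventually.of_forall fun n => Eventually.of_forall fun x => ?_
      rw [norm_mul, Real.norm_eq_abs, Real.norm_eq_abs]
      exact mul_le_of_le_one_left (abs_nonneg _) (hcut_abs _)
    · refine Eventually.of_forall fun x => ?_
      apply tendsto_const_nhds.congr'
      filter_upwards [eventually_ge_atTop ‖x‖, eventually_gt_atTop 0] with n hn hn0
      have : ecut n x = 1 := by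
        apply hcut_one
        rw [← mul_pow, ← div_eq_mul_inv]
        apply pow_le_one₀ (by positivity)
        rw [div_le_one hn0]; exact hn
      rw [this, one_mul]
  refine tendsto_nhds_unique h2 (h1.congr' ?_)
  filter_upwards [eventually_gt_atTop 0] with n hn
  exact (cut_parts F hF hn).symm

/-- Divergence theorem, compactly supported fields. -/
theorem div_compact (F : E3 → Fin 3 → ℝ) (hF : ∀ i, ContDiff ℝ (⊤ : ℕ∞) fun x => F x i)
    (hs : ∀ i, HasCompactSupport fun x => F x i) :
    Integrable (fun x => ∑ l, pd l (fun y => F y l) x) ∧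
    ∫ x, ∑ l, pd l (fun y => F y l) x = 0 := by
  have hi : ∀ l, Integrable (fun x => pd l (fun y => F y l) x) := fun l =>
    (pd_cont (hF l) l).integrable_of_hasCompactSupport ((hs l).fderiv_apply ℝ _)
  have hint := integrable_finsetSum Finset.univ (fun l _ => hi l)
  refine ⟨hint, ?_⟩
  rw [integral_finsetSum _ (fun l _ => hi l)]
  refine Finset.sum_eq_zero fun l _ => ?_
  have := integral_mul_fderiv_eq_neg_fderiv_mul_of_integrable (μ := (volume : Measure E3)) 
    (f := fun _ : E3 => (1:ℝ)) (g := fun y => F y l) (v := EuclideanSpace.single l 1) ?_ ?_ ?_ 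
    (by fun_prop) (fun x _ => ((hF l).differentiable (by simp)) x)
  · simpa [pd] using this
  · simp
  · simpa [pd] using hi l
  · simpa using (hF l).continuous.integrable_of_hasCompactSupport (hs l)

section calculus

variable {f g : E3 → ℝ}

lemma sm_d (hf : ContDiff ℝ (⊤ : ℕ∞) f) (x : E3) : DifferentiableAt ℝ f x :=
  (hf.differentiable (by simp)) x

lemma pd_sm (hf : ContDiff ℝ (⊤ : ℕ∞) f) (i : Fin 3) : ContDiff ℝ (⊤ : ℕ∞) (pd i f) := by
  have : ContDiff ℝ (⊤ : ℕ∞) (fderiv ℝ f) := hf.fderiv_right (by simp)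
  exact this.clm_apply contDiff_const

lemma pd_add (hf : ContDiff ℝ (⊤ : ℕ∞) f) (hg : ContDiff ℝ (⊤ : ℕ∞) g) (i : Fin 3) (x : E3) :
    pd i (fun y => f y + g y) x = pd i f x + pd i g x := by
  simp only [pd]; rw [fderiv_fun_add (sm_d hf x) (sm_d hg x)]; rfl

lemma pd_sub (hf : ContDiff ℝ (⊤ : ℕ∞) f) (hg : ContDiff ℝ (⊤ : ℕ∞) g) (i : Fin 3) (x : E3) :
    pd i (fun y => f y - g y) x = pd i f x - pd i g x := by
  simp only [pd]; rw [fderiv_fun_sub (sm_d hf x) (sm_d hg x)]; rfl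

lemma pd_mul (hf : ContDiff ℝ (⊤ : ℕ∞) f) (hg : ContDiff ℝ (⊤ : ℕ∞) g) (i : Fin 3) (x : E3) :
    pd i (fun y => f y * g y) x = pd i f x * g x + f x * pd i g x := by
  simp only [pd]; rw [fderiv_fun_mul (sm_d hf x) (sm_d hg x)]
  simp; ring

lemma pd_const_mul (hf : ContDiff ℝ (⊤ : ℕ∞) f) (c : ℝ) (i : Fin 3) (x : E3) :
    pd i (fun y => c * f y) x = c * pd i f x := by
  rw [pd_mul contDiff_const hf]
  simp [pd]

lemma pd_pow (hf : ContDiff ℝ (⊤ : ℕ∞) f) (n : ℕ) (i : Fin 3) (x : E3) :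
    pd i (fun y => f y ^ n) x = n * f x ^ (n - 1) * pd i f x := by
  simp only [pd]; rw [fderiv_fun_pow n (sm_d hf x)]
  simp

lemma pd_sum {u : Fin 3 → E3 → ℝ} (hu : ∀ k, ContDiff ℝ (⊤ : ℕ∞) (u k)) (i : Fin 3) (x : E3) :
    pd i (fun y => ∑ k, u k y) x = ∑ k, pd i (u k) x := by
  simp only [pd]; rw [fderiv_fun_sum (fun k _ => sm_d (hu k) x)]
  simp

lemma coord_sm (k : Fin 3) : ContDiff ℝ (⊤ : ℕ∞) (fun y : E3 => y k) :=
  contDiff_euclidean.1 contDiff_id k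

lemma pd_coord (l k : Fin 3) (x : E3) : pd l (fun y : E3 => y k) x = if l = k then 1 else 0 := by
  have : (fun y : E3 => y k) = (EuclideanSpace.proj k : E3 →L[ℝ] ℝ) := rfl
  rw [pd, this, ContinuousLinearMap.fderiv]
  simp [eq_comm]

lemma pd_comm (hf : ContDiff ℝ (⊤ : ℕ∞) f) (i k : Fin 3) (x : E3) :
    pd i (pd k f) x = pd k (pd i f) x := by
  have hs : IsSymmSndFDerivAt ℝ f x := hf.contDiffAt.isSymmSndFDerivAt (by
    rw [minSmoothness_of_isRCLikeNormedField]; exact WithTop.coe_le_coe.2 le_top)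
  have hd : DifferentiableAt ℝ (fderiv ℝ f) x := 
    ((hf.fderiv_right (m := (⊤ : ℕ∞)) (by simp)).differentiable (by simp)) x
  have : ∀ a b : Fin 3, pd a (pd b f) x = 
      fderiv ℝ (fderiv ℝ f) x (EuclideanSpace.single a 1) (EuclideanSpace.single b 1) := by
    intro a b
    have h : pd b f = fun y => (fderiv ℝ f y) (EuclideanSpace.single b (1:ℝ)) := rfl
    rw [pd, h, fderiv_clm_apply hd (by fun_prop)]
    simp
  rw [this, this]; exact hs _ _

/-- Euler operator `x · ∇`. -/
lemma pd_X (hf : ContDiff ℝ (⊤ : ℕ∞) f) (l : Fin 3) (x : E3) :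
    pd l (fun y => ∑ k, y k * pd k f y) x = pd l f x + ∑ k, x k * pd k (pd l f) x := by
  rw [pd_sum (fun k => (coord_sm k).mul (pd_sm hf k))]
  simp only [pd_mul (coord_sm _) (pd_sm hf _), pd_coord, Finset.sum_add_distrib, ite_mul, one_mul, zero_mul,
    Finset.sum_ite_eq, Finset.mem_univ, if_true, pd_comm hf l]

lemma X_sm (hf : ContDiff ℝ (⊤ : ℕ∞) f) : ContDiff ℝ (⊤ : ℕ∞) (fun y => ∑ k, y k * pd k f y) :=
  ContDiff.sum fun k _ => (coord_sm k).mul (pd_sm hf k)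

lemma div_contract {Q : Fin 3 → Fin 3 → E3 → ℝ} {u : Fin 3 → E3 → ℝ}
    (hQ : ∀ i l, ContDiff ℝ (⊤ : ℕ∞) (Q i l)) (hu : ∀ i, ContDiff ℝ (⊤ : ℕ∞) (u i)) (x : E3) :
    ∑ l, pd l (fun y => ∑ i, Q i l y * u i y) x
      = ∑ i, (∑ l, pd l (Q i l) x) * u i x + ∑ i, ∑ l, Q i l x * pd l (u i) x := by
  have e : ∀ l, pd l (fun y => ∑ i, Q i l y * u i y) x
      = ∑ i, (pd l (Q i l) x * u i x + Q i l x * pd l (u i) x) := by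
    intro l
    rw [pd_sum (fun i => (hQ i l).mul (hu i))]
    exact Finset.sum_congr rfl fun i _ => pd_mul (hQ i l) (hu i) l x
  rw [Finset.sum_congr rfl (fun l _ => e l)]
  simp only [Fin.sum_univ_three]
  ring

lemma div_coord (hf : ContDiff ℝ (⊤ : ℕ∞) f) (x : E3) :
    ∑ k, pd k (fun y => f y * y k) x = ∑ k, x k * pd k f x + 3 * f x := by
  simp only [pd_mul hf (coord_sm _), pd_coord, Fin.sum_univ_three]
  simp; ring

lemma pohozaev (hf : ContDiff ℝ (⊤ : ℕ∞) f) (hg : ContDiff ℝ (⊤ : ℕ∞) g) (x : E3) :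
    ∑ k, pd k (fun y => (∑ i, y i * pd i f y) * pd k g y + (∑ i, y i * pd i g y) * pd k f y
          - (∑ i, pd i f y * pd i g y) * y k) x
      = (∑ i, x i * pd i f x) * lap g x + (∑ i, x i * pd i g x) * lap f x
        - ∑ i, pd i g x * pd i f x := by
  have hG : ContDiff ℝ (⊤ : ℕ∞) (fun y => ∑ i, pd i f y * pd i g y) :=
    ContDiff.sum fun i _ => (pd_sm hf i).mul (pd_sm hg i)
  have h1 := fun k => (X_sm hf).mul (pd_sm hg k)
  have h2 := fun k => (X_sm hg).mul (pd_sm hf k)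
  have h3 := fun k => hG.mul (coord_sm k)
  have e : ∀ k, pd k (fun y => (∑ i, y i * pd i f y) * pd k g y + (∑ i, y i * pd i g y) * pd k f y
          - (∑ i, pd i f y * pd i g y) * y k) x 
      = ((pd k f x + ∑ i, x i * pd i (pd k f) x) * pd k g x + (∑ i, x i * pd i f x) * pd k (pd k g) x)
       + ((pd k g x + ∑ i, x i * pd i (pd k g) x) * pd k f x + (∑ i, x i * pd i g x) * pd k (pd k f) x)
       - ((∑ i, (pd k (pd i f) x * pd i g x + pd i f x * pd k (pd i g) x)) * x k 
          + (∑ i, pd i f x * pd i g x)) := by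
    intro k
    rw [pd_sub ((h1 k).add (h2 k)) (h3 k), pd_add (h1 k) (h2 k), pd_mul (X_sm hf) (pd_sm hg k),
      pd_mul (X_sm hg) (pd_sm hf k), pd_mul hG (coord_sm k), pd_X hf, pd_X hg, pd_coord,
      pd_sum (fun i => (pd_sm hf i).mul (pd_sm hg i))]
    simp only [pd_mul (pd_sm hf _) (pd_sm hg _), if_true, mul_one]
  rw [Finset.sum_congr rfl (fun l _ => e l)]
  simp only [lap, Fin.sum_univ_three]
  ring

lemma div_grad (hf : ContDiff ℝ (⊤ : ℕ∞) f) (hg : ContDiff ℝ (⊤ : ℕ∞) g) (x : E3) :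
    ∑ k, pd k (fun y => f y * pd k g y) x = f x * lap g x + ∑ i, pd i f x * pd i g x := by
  simp only [pd_mul hf (pd_sm hg _), lap, Fin.sum_univ_three]; ring

end calculus

section curvature

variable {α : E3 → ℝ} {β : E3 → Fin 3 → ℝ}

lemma Khat_sm (hα : ∀ x, 0 < α x) (hαC : ContDiff ℝ (⊤ : ℕ∞) α)
    (hβC : ∀ i, ContDiff ℝ (⊤ : ℕ∞) fun x => β x i) (i l : Fin 3) :
    ContDiff ℝ (⊤ : ℕ∞) (Khat α β i l) := by
  unfold Khat
  refine ContDiff.mul (ContDiff.div contDiff_const (contDiff_const.mul hαC)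
    (fun x => by have := hα x; positivity)) ?_
  refine ((pd_sm (hβC l) i).add (pd_sm (hβC i) l)).sub (contDiff_const.mul ?_)
  exact ContDiff.sum fun k _ => pd_sm (hβC k) k

lemma Khat_symm (i l : Fin 3) (x : E3) : Khat α β i l x = Khat α β l i x := by
  simp only [Khat, eq_comm (a := i) (b := l)]; ring

lemma Khat_trace (x : E3) : Khat α β 0 0 x + Khat α β 1 1 x + Khat α β 2 2 x = 0 := by
  simp only [Khat, Fin.sum_univ_three]; simp; ring

lemma alpha_Khat (hα : ∀ x, 0 < α x) (i l : Fin 3) (x : E3) :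
    α x * Khat α β i l x = (1/2) * (pd i (fun y => β y l) x + pd l (fun y => β y i) x
      - ((2 / 3) * (if i = l then (1 : ℝ) else 0)) * ∑ k, pd k (fun y => β y k) x) := by
  have := (hα x).ne'
  simp only [Khat]; field_simp

lemma matrix_contract (K B M : Fin 3 → Fin 3 → ℝ) (hK : ∀ i l, K i l = K l i)
    (ht : K 0 0 + K 1 1 + K 2 2 = 0)
    (hM : ∀ i l, M i l = (1/2) * (B i l + B l i - ((2 / 3) * (if i = l then (1 : ℝ) else 0)) *
      ∑ k, B k k)) :
    ∑ i, ∑ l, K i l * B l i = ∑ i, ∑ l, K i l * M i l := by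
  simp only [hM, Fin.sum_univ_three]
  simp [hK 1 0, hK 2 0, hK 2 1]
  linear_combination (1/3) * (B 0 0 + B 1 1 + B 2 2) * ht

lemma KK_eq (x : E3) : KK α β x = ∑ i, ∑ l, Khat α β i l x * Khat α β i l x := by
  simp only [KK]
  refine Finset.sum_congr rfl fun i _ => Finset.sum_congr rfl fun l _ => ?_
  rw [Khat_symm l i]

lemma KK_sm (hα : ∀ x, 0 < α x) (hαC : ContDiff ℝ (⊤ : ℕ∞) α)
    (hβC : ∀ i, ContDiff ℝ (⊤ : ℕ∞) fun x => β x i) : ContDiff ℝ (⊤ : ℕ∞) (KK α β) := by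
  unfold KK
  exact ContDiff.sum fun i _ => ContDiff.sum fun l _ =>
    (Khat_sm hα hαC hβC i l).mul (Khat_sm hα hαC hβC l i)

lemma K_dβ (hα : ∀ x, 0 < α x) (x : E3) :
    ∑ i, ∑ l, Khat α β i l x * pd l (fun y => β y i) x = α x * KK α β x := by
  rw [matrix_contract (fun i l => Khat α β i l x) (fun l i => pd l (fun y => β y i) x)
    (fun i l => α x * Khat α β i l x) (fun i l => Khat_symm i l x) (Khat_trace x)
    (fun i l => alpha_Khat hα i l x), KK_eq]
  simp only [Finset.mul_sum]
  refine Finset.sum_congr rfl fun i _ => Finset.sum_congr rfl fun l _ => ?_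
  ring

lemma pd_KK (hα : ∀ x, 0 < α x) (hαC : ContDiff ℝ (⊤ : ℕ∞) α)
    (hβC : ∀ i, ContDiff ℝ (⊤ : ℕ∞) fun x => β x i) (k : Fin 3) (x : E3) :
    pd k (KK α β) x = 2 * ∑ i, ∑ l, Khat α β i l x * pd k (Khat α β i l) x := by
  have e : KK α β = fun y => ∑ i, ∑ l, Khat α β i l y * Khat α β i l y := funext KK_eq
  have hK := Khat_sm hα hαC hβC
  rw [e, pd_sum (fun i => ContDiff.sum fun l _ => (hK i l).mul (hK i l)), Finset.mul_sum]
  refine Finset.sum_congr rfl fun i _ => ?_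
  rw [pd_sum (fun l => (hK i l).mul (hK i l)), Finset.mul_sum]
  refine Finset.sum_congr rfl fun l _ => ?_
  rw [pd_mul (hK i l) (hK i l)]; ring

lemma K_ddβ (hα : ∀ x, 0 < α x) (hαC : ContDiff ℝ (⊤ : ℕ∞) α)
    (hβC : ∀ i, ContDiff ℝ (⊤ : ℕ∞) fun x => β x i) (k : Fin 3) (x : E3) :
    ∑ i, ∑ l, Khat α β i l x * pd k (pd l (fun y => β y i)) x
      = pd k α x * KK α β x + (1/2) * α x * pd k (KK α β) x := by
  have hK := Khat_sm hα hαC hβC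
  rw [matrix_contract (fun i l => Khat α β i l x) (fun l i => pd k (pd l (fun y => β y i)) x)
    (fun i l => pd k α x * Khat α β i l x + α x * pd k (Khat α β i l) x)
    (fun i l => Khat_symm i l x) (Khat_trace x) ?_, pd_KK hα hαC hβC, KK_eq]
  · simp only [Fin.sum_univ_three]; ring
  · intro i l
    rw [← pd_mul hαC (hK i l)]
    simp only [alpha_Khat hα]
    have h1 := pd_sm (hβC l) i
    have h2 := pd_sm (hβC i) l
    have h3 : ∀ k, ContDiff ℝ (⊤ : ℕ∞) (pd k (fun y => β y k)) := fun k => pd_sm (hβC k) k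
    have h4 : ContDiff ℝ (⊤ : ℕ∞) (fun y => ∑ k, pd k (fun y => β y k) y) := 
      ContDiff.sum fun k _ => h3 k
    rw [pd_const_mul ((h1.add h2).sub (contDiff_const.mul h4)), 
      pd_sub (h1.add h2) (contDiff_const.mul h4), pd_add h1 h2, pd_const_mul h4, pd_sum h3]

end curvature

lemma comb_zero {f1 f2 f3 f4 f5 f6 f7 f8 : E3 → ℝ}
    (i1 : Integrable f1) (i2 : Integrable f2) (i3 : Integrable f3) (i4 : Integrable f4)
    (i5 : Integrable f5) (i6 : Integrable f6) (i7 : Integrable f7) (i8 : Integrable f8)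
    (z1 : ∫ x, f1 x = 0) (z2 : ∫ x, f2 x = 0) (z3 : ∫ x, f3 x = 0) (z4 : ∫ x, f4 x = 0)
    (z5 : ∫ x, f5 x = 0) (z6 : ∫ x, f6 x = 0) (z7 : ∫ x, f7 x = 0) (z8 : ∫ x, f8 x = 0)
    (a b c d e f : ℝ) :
    ∫ x, (a * f1 x + b * f2 x + f3 x + f4 x + c * f5 x + d * f6 x + e * f7 x + f * f8 x) = 0 := by
  have h2 := (i1.const_mul a).fun_add (i2.const_mul b)
  have h3 := h2.fun_add i3
  have h4 := h3.fun_add i4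
  have h5 := h4.fun_add (i5.const_mul c)
  have h6 := h5.fun_add (i6.const_mul d)
  have h7 := h6.fun_add (i7.const_mul e)
  rw [integral_add h7 (i8.const_mul f), integral_add h6 (i7.const_mul e),
    integral_add h5 (i6.const_mul d), integral_add h4 (i5.const_mul c), integral_add h3 i4,
    integral_add h2 i3, integral_add (i1.const_mul a) (i2.const_mul b)]
  simp only [integral_const_mul, z1, z2, z3, z4, z5, z6, z7, z8]
  simp

/-- Virial relation for binary neutron stars in IWM spacetimes (Eq. virial), and the
consequent equality of the Komar-type mass `M_χ` and the ADM mass: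
`∫ [ψ⁶ j_k v^k + 3αψ⁶P + (1/2π)∇χ·∇ψ − ½ψ⁶ j_k β^k] dV = 0` and `M_χ = M_ADM`. -/
theorem iwm_virial_relation
    (α ψ : E3 → ℝ) (β j v : E3 → Fin 3 → ℝ) (ρH P : E3 → ℝ) (Ω b Mχ MADM : ℝ)
    (hα : ∀ x, 0 < α x) (hψ : ∀ x, 0 < ψ x)
    (hαC : ContDiff ℝ (⊤ : ℕ∞) α) (hψC : ContDiff ℝ (⊤ : ℕ∞) ψ)
    (hβC : ∀ i, ContDiff ℝ (⊤ : ℕ∞) fun x => β x i)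
    (hjC : ∀ i, ContDiff ℝ (⊤ : ℕ∞) fun x => j x i)
    (hvC : ∀ i, ContDiff ℝ (⊤ : ℕ∞) fun x => v x i)
    (hρHC : ContDiff ℝ (⊤ : ℕ∞) ρH) (hPC : ContDiff ℝ (⊤ : ℕ∞) P)
    (hjsupp : ∀ i, HasCompactSupport fun x => j x i)
    (hvsupp : ∀ i, HasCompactSupport fun x => v x i)
    (hρHsupp : HasCompactSupport ρH) (hPsupp : HasCompactSupport P)
    -- (i) Hamiltonian constraint
    (hham : ∀ x : E3,
      lap ψ x = -(2 * π) * ψ x ^ 5 * ρH x - (ψ x ^ 5 / 8) * KK α β x)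
    -- (i) slicing equation, with S = j_k (v^k + β^k)/α + 3P
    (hslice : ∀ x : E3,
      lap (chi α ψ) x
        = 2 * π * chi α ψ x * ψ x ^ 4
            * (ρH x + 2 * ((∑ k, j x k * (v x k + β x k)) / α x + 3 * P x))
          + (7 / 8) * chi α ψ x * ψ x ^ 4 * KK α β x)
    -- (i) momentum constraint
    (hmom : ∀ x : E3, ∀ i : Fin 3,
      (∑ l, pd l (fun y => ψ y ^ 6 * Khat α β i l y) x) = 8 * π * j x i * ψ x ^ 6)
    -- (ii) helically symmetric Euler equation
    (heuler : ∀ x : E3, ∀ k : Fin 3,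
      -Ω * ((∑ l, pd l (fun y => phib b y l * (ψ y ^ 6 * j y k)) x)
            + ∑ l, ψ x ^ 6 * j x l * pd k (fun y => phib b y l) x)
        + (∑ l, pd l (fun y => ψ y ^ 6 * j y k * v y l) x)
        + pd k (fun y => α y * ψ y ^ 6 * P y) x
        + ρH x * ψ x ^ 5 * pd k (chi α ψ) x
        - (ρH x + 2 * ((∑ l, j x l * (v x l + β x l)) / α x + 3 * P x))
            * chi α ψ x * ψ x ^ 4 * pd k ψ x
        - ψ x ^ 6 * ∑ l, j x l * pd k (fun y => β y l) x = 0)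
    -- (iii) vanishing total ADM 3-momentum
    (hADM : ∀ i : Fin 3,
      Tendsto (flux fun x l => ψ x ^ 6 * Khat α β i l x) atTop (𝓝 0))
    -- (iv) vanishing fluxes at infinity
    (hflux1 : Tendsto (flux fun x l =>
      ψ x ^ 6 * ∑ i, Khat α β i l x * β x i) atTop (𝓝 0))
    (hflux2 : Tendsto (flux fun x l =>
      ψ x ^ 6 * ∑ i, Khat α β i l x * ∑ k, x k * pd k (fun y => β y i) x)
      atTop (𝓝 0))
    (hflux3 : Tendsto (flux fun x k =>
      ψ x ^ 6 * ∑ i, Khat α β i k x * ∑ l, x l * pd l (fun y => β y i) x)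
      atTop (𝓝 0))
    (hflux4 : Tendsto (flux fun x k =>
      α x * ψ x ^ 6 * KK α β x * x k) atTop (𝓝 0))
    (hflux5 : Tendsto (flux fun x k =>
      (∑ i, x i * pd i ψ x) * pd k (chi α ψ) x
        + (∑ i, x i * pd i (chi α ψ) x) * pd k ψ x
        - (∑ i, pd i ψ x * pd i (chi α ψ) x) * x k) atTop (𝓝 0))
    -- (iv) the flux limits defining M_χ and M_ADM exist
    (hMχ : Tendsto (fun r => (1 / (2 * π)) *
      flux (fun x i => ψ x * pd i (chi α ψ) x) r) atTop (𝓝 Mχ))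
    (hMADM : Tendsto (fun r => -(1 / (2 * π)) *
      flux (fun x i => chi α ψ x * pd i ψ x) r) atTop (𝓝 MADM))
    -- (iv) integrability of the displayed integrands
    (hint1 : Integrable fun x : E3 =>
      ψ x ^ 6 * (∑ k, j x k * v x k) + 3 * α x * ψ x ^ 6 * P x
        + (1 / (2 * π)) * (∑ i, pd i (chi α ψ) x * pd i ψ x)
        - (1 / 2) * ψ x ^ 6 * (∑ k, j x k * β x k))
    (hint2 : Integrable fun x : E3 => ∑ i, pd i (chi α ψ) x * pd i ψ x)
    (hint3 : Integrable fun x : E3 => α x * ψ x ^ 6 * KK α β x)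
    (hint4 : Integrable fun x : E3 => ψ x ^ 6 * ∑ k, j x k * β x k)
    (hint5 : Integrable fun x : E3 =>
      ψ x ^ 12 * KK α β x * ∑ k, x k * pd k (fun y => α y / ψ y ^ 6) x)
    (hint6 : Integrable fun x : E3 =>
      ψ x * lap (chi α ψ) x + ∑ i, pd i (chi α ψ) x * pd i ψ x)
    (hint7 : Integrable fun x : E3 =>
      chi α ψ x * lap ψ x - ∑ i, pd i ψ x * pd i (chi α ψ) x)
    (hint8 : Integrable fun x : E3 =>
      (∑ i, x i * pd i ψ x) * lap (chi α ψ) x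
        + (∑ i, x i * pd i (chi α ψ) x) * lap ψ x)
    (hint9 : Integrable fun x : E3 =>
      ∑ l, pd l (fun y => ψ y ^ 6 * ∑ i, Khat α β i l y * β y i) x)
    (hint10 : Integrable fun x : E3 =>
      ∑ l, pd l (fun y =>
        ψ y ^ 6 * ∑ i, Khat α β i l y * ∑ k, y k * pd k (fun z => β z i) y) x)
    (hint11 : Integrable fun x : E3 =>
      ∑ k, pd k (fun y => α y * ψ y ^ 6 * KK α β y * y k) x)
    (hint12 : Integrable fun x : E3 =>
      ∑ k, pd k (fun y =>
        (∑ i, y i * pd i ψ y) * pd k (chi α ψ) y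
          + (∑ i, y i * pd i (chi α ψ) y) * pd k ψ y
          - (∑ i, pd i ψ y * pd i (chi α ψ) y) * y k) x) :
    (∫ x : E3,
        ψ x ^ 6 * (∑ k, j x k * v x k) + 3 * α x * ψ x ^ 6 * P x
          + (1 / (2 * π)) * (∑ i, pd i (chi α ψ) x * pd i ψ x)
          - (1 / 2) * ψ x ^ 6 * (∑ k, j x k * β x k)) = 0
      ∧ Mχ = MADM := by
  have hχC : ContDiff ℝ (⊤ : ℕ∞) (chi α ψ) := hαC.mul hψC
  have hψ6 : ContDiff ℝ (⊤ : ℕ∞) (fun y => ψ y ^ 6) := hψC.pow 6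
  have hK := Khat_sm hα hαC hβC
  have hKK := KK_sm hα hαC hβC
  have hQ : ∀ i l, ContDiff ℝ (⊤ : ℕ∞) (fun y => ψ y ^ 6 * Khat α β i l y) :=
    fun i l => hψ6.mul (hK i l)
  have hXβ : ∀ i, ContDiff ℝ (⊤ : ℕ∞) (fun y => ∑ k, y k * pd k (fun z => β z i) y) :=
    fun i => X_sm (hβC i)
  have hφ : ∀ l, ContDiff ℝ (⊤ : ℕ∞) (fun y => phib b y l) := by
    intro l
    fin_cases l
    · exact (coord_sm 1).neg
    · exact (coord_sm 0).sub contDiff_const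
    · exact contDiff_const
  -- compactly supported fields
  have hg1 : ∀ k l, ContDiff ℝ (⊤ : ℕ∞) (fun y => phib b y l * (ψ y ^ 6 * j y k)) :=
    fun k l => (hφ l).mul (hψ6.mul (hjC k))
  have hg2 : ∀ k l, ContDiff ℝ (⊤ : ℕ∞) (fun y => ψ y ^ 6 * j y k * v y l) :=
    fun k l => (hψ6.mul (hjC k)).mul (hvC l)
  have hg3 : ContDiff ℝ (⊤ : ℕ∞) (fun y => α y * ψ y ^ 6 * P y) := (hαC.mul hψ6).mul hPC
  obtain ⟨iV1, zV1⟩ := div_compact (fun y l => ∑ k, (phib b y l * (ψ y ^ 6 * j y k)) * y k)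
    (fun l => ContDiff.sum fun k _ => (hg1 k l).mul (coord_sm k))
    (fun l => by
      simp only [Fin.sum_univ_three]
      exact (((hjsupp 0).mul_left.mul_left.mul_right).add
        ((hjsupp 1).mul_left.mul_left.mul_right)).add ((hjsupp 2).mul_left.mul_left.mul_right))
  obtain ⟨iV2, zV2⟩ := div_compact (fun y l => ∑ k, (ψ y ^ 6 * j y k * v y l) * y k)
    (fun l => ContDiff.sum fun k _ => (hg2 k l).mul (coord_sm k))
    (fun l => by
      simp only [Fin.sum_univ_three]
      exact (((hvsupp l).mul_left.mul_right).add
        ((hvsupp l).mul_left.mul_right)).add ((hvsupp l).mul_left.mul_right))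
  obtain ⟨iV3, zV3⟩ := div_compact (fun y l => α y * ψ y ^ 6 * P y * y l)
    (fun l => hg3.mul (coord_sm l))
    (fun l => hPsupp.mul_left.mul_right)
  -- the other fields
  have i0 : Integrable (fun x => ∑ l, pd l (fun y => ψ y ^ 6 * Khat α β 1 l y) x) := by
    simp only [hmom]
    exact (Continuous.integrable_of_hasCompactSupport
      ((continuous_const.mul (hjC 1).continuous).mul hψ6.continuous)
      ((hjsupp 1).mul_left.mul_right))
  have z0 := div_thm (fun x l => ψ x ^ 6 * Khat α β 1 l x) (hQ 1) 0 (hADM 1) i0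
  have z1 := div_thm (fun x l => ψ x ^ 6 * ∑ i, Khat α β i l x * β x i)
    (fun l => hψ6.mul (ContDiff.sum fun i _ => (hK i l).mul (hβC i))) 0 hflux1 hint9
  have z2 := div_thm (fun x l =>
      ψ x ^ 6 * ∑ i, Khat α β i l x * ∑ k, x k * pd k (fun y => β y i) x)
    (fun l => hψ6.mul (ContDiff.sum fun i _ => (hK i l).mul (hXβ i))) 0 hflux2 hint10
  have hg4 : ContDiff ℝ (⊤ : ℕ∞) (fun y => α y * ψ y ^ 6 * KK α β y) := (hαC.mul hψ6).mul hKK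
  have z4 := div_thm (fun x k => α x * ψ x ^ 6 * KK α β x * x k)
    (fun l => hg4.mul (coord_sm l)) 0 hflux4 hint11
  have hG : ContDiff ℝ (⊤ : ℕ∞) (fun y => ∑ i, pd i ψ y * pd i (chi α ψ) y) :=
    ContDiff.sum fun i _ => (pd_sm hψC i).mul (pd_sm hχC i)
  have z5 := div_thm (fun x k => (∑ i, x i * pd i ψ x) * pd k (chi α ψ) x
        + (∑ i, x i * pd i (chi α ψ) x) * pd k ψ x
        - (∑ i, pd i ψ x * pd i (chi α ψ) x) * x k)
    (fun l => (((X_sm hψC).mul (pd_sm hχC l)).add ((X_sm hχC).mul (pd_sm hψC l))).sub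
      (hG.mul (coord_sm l))) 0 hflux5 hint12
  beta_reduce at iV1 zV1 iV2 zV2 iV3 zV3 z0 z1 z2 z4 z5
  -- pointwise identities
  have hF1 : ∀ x, ∑ l, pd l (fun y => ψ y ^ 6 * ∑ i, Khat α β i l y * β y i) x
      = 8 * π * (ψ x ^ 6 * ∑ k, j x k * β x k) + α x * ψ x ^ 6 * KK α β x := by
    intro x
    have e : ∀ l, (fun y => ψ y ^ 6 * ∑ i, Khat α β i l y * β y i)
        = fun y => ∑ i, (ψ y ^ 6 * Khat α β i l y) * β y i := by
      intro l; funext y; rw [Finset.mul_sum]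
      exact Finset.sum_congr rfl fun i _ => by ring
    have h := div_contract (Q := fun i l y => ψ y ^ 6 * Khat α β i l y) (u := fun i y => β y i)
      hQ hβC x
    simp only [e]
    rw [h, Finset.sum_congr rfl (fun i _ => by rw [hmom x i])]
    have h2 := K_dβ (β := β) hα x
    simp only [Fin.sum_univ_three] at h2 ⊢
    linear_combination ψ x ^ 6 * h2
  have hF2 : ∀ x, ∑ l, pd l (fun y =>
        ψ y ^ 6 * ∑ i, Khat α β i l y * ∑ k, y k * pd k (fun z => β z i) y) x
      = 8 * π * (ψ x ^ 6 * ∑ i, j x i * ∑ k, x k * pd k (fun z => β z i) x)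
        + α x * ψ x ^ 6 * KK α β x + ψ x ^ 6 * (KK α β x * (∑ k, x k * pd k α x)
          + (1/2) * α x * ∑ k, x k * pd k (KK α β) x) := by
    intro x
    have e : ∀ l, (fun y => ψ y ^ 6 * ∑ i, Khat α β i l y * ∑ k, y k * pd k (fun z => β z i) y)
        = fun y => ∑ i, (ψ y ^ 6 * Khat α β i l y) * ∑ k, y k * pd k (fun z => β z i) y := by
      intro l; funext y; rw [Finset.mul_sum]
      exact Finset.sum_congr rfl fun i _ => by ring
    have h := div_contract (Q := fun i l y => ψ y ^ 6 * Khat α β i l y)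
      (u := fun i y => ∑ k, y k * pd k (fun z => β z i) y) hQ hXβ x
    have ex : ∀ i l, pd l (fun y => ∑ k, y k * pd k (fun z => β z i) y) x
        = pd l (fun z => β z i) x + ∑ k, x k * pd k (pd l (fun z => β z i)) x :=
      fun i l => pd_X (hβC i) l x
    rw [Finset.sum_congr rfl (fun l _ => by rw [e l]), h,
      Finset.sum_congr rfl (fun i _ => by rw [hmom x i])]
    rw [Finset.sum_congr (s₁ := Finset.univ) (g := fun i => ∑ l, ψ x ^ 6 * Khat α β i l x *
      (pd l (fun z => β z i) x + ∑ k, x k * pd k (pd l (fun z => β z i)) x)) rfl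
      (fun i _ => Finset.sum_congr rfl fun l _ => by rw [ex i l])]
    have h2 := K_dβ (β := β) hα x
    have h3 := fun k => K_ddβ hα hαC hβC k x
    have h30 := h3 0
    have h31 := h3 1
    have h32 := h3 2
    clear h3 ex h e
    simp only [Fin.sum_univ_three] at h2 h30 h31 h32 ⊢
    linear_combination ψ x ^ 6 * (h2 + x 0 * h30 + x 1 * h31 + x 2 * h32)
  have hF4 : ∀ x, ∑ k, pd k (fun y => α y * ψ y ^ 6 * KK α β y * y k) x
      = 3 * (α x * ψ x ^ 6 * KK α β x) + α x * ψ x ^ 6 * (∑ k, x k * pd k (KK α β) x)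
        + KK α β x * (ψ x ^ 6 * (∑ k, x k * pd k α x)
          + 6 * α x * ψ x ^ 5 * ∑ k, x k * pd k ψ x) := by
    intro x
    have e : ∀ k, pd k (fun y => α y * ψ y ^ 6 * KK α β y) x
       = (pd k α x * ψ x ^ 6 + α x * (6 * ψ x ^ 5 * pd k ψ x)) * KK α β x
         + α x * ψ x ^ 6 * pd k (KK α β) x := by
      intro k
      rw [pd_mul (hαC.mul hψ6) hKK, pd_mul hαC hψ6, pd_pow hψC]
      norm_num
    rw [div_coord hg4 x]
    simp only [e, Fin.sum_univ_three]
    ring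
  have hV1 : ∀ x, ∑ l, pd l (fun y => ∑ k, (phib b y l * (ψ y ^ 6 * j y k)) * y k) x
      = ∑ k, x k * (∑ l, pd l (fun y => phib b y l * (ψ y ^ 6 * j y k)) x)
        + ψ x ^ 6 * ∑ k, phib b x k * j x k := by
    intro x
    rw [div_contract (Q := fun k l y => phib b y l * (ψ y ^ 6 * j y k)) (u := fun k y => y k)
      hg1 coord_sm x]
    simp only [pd_coord, mul_ite, mul_one, mul_zero, Finset.sum_ite_eq', Finset.mem_univ, if_true]
    simp only [Finset.mul_sum]
    congr 1
    · exact Finset.sum_congr rfl fun k _ => by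
        rw [Finset.sum_mul]; exact Finset.sum_congr rfl fun l _ => by ring
    · exact Finset.sum_congr rfl fun k _ => by ring
  have hV2 : ∀ x, ∑ l, pd l (fun y => ∑ k, (ψ y ^ 6 * j y k * v y l) * y k) x
      = ∑ k, x k * (∑ l, pd l (fun y => ψ y ^ 6 * j y k * v y l) x)
        + ψ x ^ 6 * ∑ k, j x k * v x k := by
    intro x
    rw [div_contract (Q := fun k l y => ψ y ^ 6 * j y k * v y l) (u := fun k y => y k)
      hg2 coord_sm x]
    simp only [pd_coord, mul_ite, mul_one, mul_zero, Finset.sum_ite_eq', Finset.mem_univ, if_true]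
    simp only [Finset.mul_sum]
    congr 1
    · exact Finset.sum_congr rfl fun k _ => by
        rw [Finset.sum_mul]; exact Finset.sum_congr rfl fun l _ => by ring
    · exact Finset.sum_congr rfl fun k _ => by ring
  have hV3 := fun x => div_coord hg3 x
  have hT1' : ∀ x : E3, ∑ k, x k * (∑ l, ψ x ^ 6 * j x l * pd k (fun y => phib b y l) x)
      = ψ x ^ 6 * (∑ k, phib b x k * j x k) + b * (ψ x ^ 6 * j x 1) := by
    intro x
    have p0 : ∀ k, pd k (fun y => phib b y 0) x = - (if k = 1 then 1 else 0) := by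
      intro k
      have : (fun y => phib b y 0) = fun y : E3 => (-1) * y 1 := by funext y; simp [phib]
      rw [this, pd_const_mul (coord_sm 1), pd_coord]; ring
    have p1 : ∀ k, pd k (fun y => phib b y 1) x = (if k = 0 then 1 else 0) := by
      intro k
      have : (fun y => phib b y 1) = fun y : E3 => y 0 - b := by funext y; simp [phib]
      rw [this, pd_sub (coord_sm 0) contDiff_const, pd_coord]
      simp [pd]
    have p2 : ∀ k, pd k (fun y => phib b y 2) x = 0 := by
      intro k
      have : (fun y => phib b y 2) = fun y : E3 => (0:ℝ) := by funext y; simp [phib]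
      rw [this]; simp [pd]
    simp only [Fin.sum_univ_three, p0, p1, p2]
    simp [phib]
    ring
  have hXχ : ∀ x, ∑ i, x i * pd i (chi α ψ) x
      = α x * (∑ i, x i * pd i ψ x) + ψ x * ∑ i, x i * pd i α x := by
    intro x
    have : ∀ i, pd i (chi α ψ) x = pd i α x * ψ x + α x * pd i ψ x := fun i => pd_mul hαC hψC i x
    simp only [this, Fin.sum_univ_three]; ring
  have hE : ∀ x : E3, -Ω * ((∑ k, x k * (∑ l, pd l (fun y => phib b y l * (ψ y ^ 6 * j y k)) x))
        + ∑ k, x k * (∑ l, ψ x ^ 6 * j x l * pd k (fun y => phib b y l) x))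
      + (∑ k, x k * (∑ l, pd l (fun y => ψ y ^ 6 * j y k * v y l) x))
      + (∑ k, x k * pd k (fun y => α y * ψ y ^ 6 * P y) x)
      + ρH x * ψ x ^ 5 * (∑ k, x k * pd k (chi α ψ) x)
      - (ρH x + 2 * ((∑ l, j x l * (v x l + β x l)) / α x + 3 * P x))
            * chi α ψ x * ψ x ^ 4 * (∑ k, x k * pd k ψ x)
      - ψ x ^ 6 * ∑ l, j x l * (∑ k, x k * pd k (fun y => β y l) x) = 0 := by
    intro x
    have h0 := heuler x 0
    have h1 := heuler x 1
    have h2 := heuler x 2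
    generalize ρH x + 2 * ((∑ l, j x l * (v x l + β x l)) / α x + 3 * P x) = R at h0 h1 h2 ⊢
    generalize hT1 : (fun k => ∑ l, pd l (fun y => phib b y l * (ψ y ^ 6 * j y k)) x) = T1
    generalize hT2 : (fun k => ∑ l, pd l (fun y => ψ y ^ 6 * j y k * v y l) x) = T2
    generalize hT3 : (fun k => ∑ l, ψ x ^ 6 * j x l * pd k (fun y => phib b y l) x) = T3
    have e1 := fun k => congrFun hT1 k
    have e2 := fun k => congrFun hT2 k
    have e3 := fun k => congrFun hT3 k
    beta_reduce at e1 e2 e3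
    rw [e1, e2, e3] at h0 h1 h2
    simp only [e1, e2, e3]
    clear hT1 hT2 hT3 e1 e2 e3
    simp only [Fin.sum_univ_three] at h0 h1 h2 ⊢
    linear_combination x 0 * h0 + x 1 * h1 + x 2 * h2
  obtain ⟨c, hcdef⟩ : ∃ c : ℝ, c = 1 / (2 * π) := ⟨_, rfl⟩
  have hc : 2 * π * c = 1 := by
    rw [hcdef]; have := Real.pi_pos; field_simp
  have key : ∀ x : E3, ψ x ^ 6 * (∑ k, j x k * v x k) + 3 * α x * ψ x ^ 6 * P x
        + c * (∑ i, pd i (chi α ψ) x * pd i ψ x)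
        - (1 / 2) * ψ x ^ 6 * (∑ k, j x k * β x k)
      = (-Ω) * (∑ l, pd l (fun y => ∑ k, (phib b y l * (ψ y ^ 6 * j y k)) * y k) x)
      + (-Ω * b * (c / 4)) * (∑ l, pd l (fun y => ψ y ^ 6 * Khat α β 1 l y) x)
      + (∑ l, pd l (fun y => ∑ k, (ψ y ^ 6 * j y k * v y l) * y k) x)
      + (∑ k, pd k (fun y => α y * ψ y ^ 6 * P y * y k) x)
      + (-c) * (∑ k, pd k (fun y =>
        (∑ i, y i * pd i ψ y) * pd k (chi α ψ) y
          + (∑ i, y i * pd i (chi α ψ) y) * pd k ψ y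
          - (∑ i, pd i ψ y * pd i (chi α ψ) y) * y k) x)
      + (-(c / 4)) * (∑ l, pd l (fun y =>
        ψ y ^ 6 * ∑ i, Khat α β i l y * ∑ k, y k * pd k (fun z => β z i) y) x)
      + (c / 8) * (∑ k, pd k (fun y => α y * ψ y ^ 6 * KK α β y * y k) x)
      + (-(c / 8)) * (∑ l, pd l (fun y => ψ y ^ 6 * ∑ i, Khat α β i l y * β y i) x) := by
    intro x
    rw [hV1, hmom, hV2, hV3, pohozaev hψC hχC, hF2, hF4, hF1]
    have e := hE x
    rw [hT1'] at e
    have hh := hham x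
    have hs := hslice x
    have hX := hXχ x
    rw [hh, hs]
    rw [hX] at e ⊢
    simp only [chi] at e ⊢
    generalize ρH x + 2 * ((∑ l, j x l * (v x l + β x l)) / α x + 3 * P x) = R at e ⊢
    clear hh hs hX hV1 hV2 hV3 hF1 hF2 hF4 hE hT1' hXχ
    generalize (∑ k, x k * (∑ l, pd l (fun y => phib b y l * (ψ y ^ 6 * j y k)) x)) = T1 at e ⊢
    generalize (∑ k, x k * (∑ l, pd l (fun y => ψ y ^ 6 * j y k * v y l) x)) = T2 at e ⊢
    generalize (∑ k, x k * pd k (fun y => α y * ψ y ^ 6 * P y) x) = T3 at e ⊢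
    generalize (∑ l, j x l * (∑ k, x k * pd k (fun y => β y l) x)) = J at e ⊢
    generalize (∑ k, x k * pd k α x) = Xa at e ⊢
    generalize (∑ k, x k * pd k ψ x) = Xp at e ⊢
    generalize (∑ k, x k * pd k (KK α β) x) = XK at e ⊢
    generalize (∑ k, phib b x k * j x k) = f1 at e ⊢
    generalize (∑ k, j x k * β x k) = f2 at e ⊢
    generalize (∑ k, j x k * v x k) = f3 at e ⊢
    generalize (∑ i, pd i (fun y => α y * ψ y) x * pd i ψ x) = f4 at e ⊢
    generalize α x = a, ψ x = p, KK α β x = q, ρH x = ρ, P x = P1, j x 1 = j1 at *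
    linear_combination (-1) * e + (Ω * b * j1 * p ^ 6 + p ^ 6 * J + (1/2) * p ^ 6 * f2
      - ρ * p ^ 5 * (a * Xp + p * Xa) + R * (a * p) * p ^ 4 * Xp) * hc
  have I0 : (∫ x : E3,
        ψ x ^ 6 * (∑ k, j x k * v x k) + 3 * α x * ψ x ^ 6 * P x
          + (1 / (2 * π)) * (∑ i, pd i (chi α ψ) x * pd i ψ x)
          - (1 / 2) * ψ x ^ 6 * (∑ k, j x k * β x k)) = 0 := by
    rw [← hcdef]
    simp only [key]
    exact comb_zero iV1 i0 iV2 iV3 hint12 hint10 hint11 hint9 zV1 z0 zV2 zV3 z5 z2 z4 z1 _ _ _ _ _ _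
  refine ⟨I0, ?_⟩
  have hpi := Real.pi_pos
  have hd1 := fun x => div_grad hψC hχC x
  have hd2 := fun x => div_grad hχC hψC x
  have hcm : ∀ x, ∑ i, pd i ψ x * pd i (chi α ψ) x = ∑ i, pd i (chi α ψ) x * pd i ψ x :=
    fun x => Finset.sum_congr rfl fun i _ => mul_comm _ _
  have iA : Integrable fun x => ∑ k, pd k (fun y => ψ y * pd k (chi α ψ) y) x := by
    simp only [hd1, hcm]; exact hint6
  have iB : Integrable fun x => ∑ k, pd k (fun y => chi α ψ y * pd k ψ y) x := by
    refine (hint7.add (hint2.const_mul 2)).congr (Eventually.of_forall fun x => ?_)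
    simp only [hd2, Pi.add_apply, hcm]; ring
  have fA : Tendsto (flux fun x i => ψ x * pd i (chi α ψ) x) atTop (𝓝 (2 * π * Mχ)) := by
    refine (hMχ.const_mul (2 * π)).congr fun r => ?_
    field_simp
  have fB : Tendsto (flux fun x i => chi α ψ x * pd i ψ x) atTop (𝓝 (-(2 * π) * MADM)) := by
    refine (hMADM.const_mul (-(2 * π))).congr fun r => ?_
    field_simp
  have zA := div_thm (fun x i => ψ x * pd i (chi α ψ) x)
    (fun i => hψC.mul (pd_sm hχC i)) _ fA iA
  have zB := div_thm (fun x i => chi α ψ x * pd i ψ x)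
    (fun i => hχC.mul (pd_sm hψC i)) _ fB iB
  beta_reduce at zA zB
  have hsum : ∀ x, (∑ k, pd k (fun y => ψ y * pd k (chi α ψ) y) x)
      + (∑ k, pd k (fun y => chi α ψ y * pd k ψ y) x)
      = 4 * π * (ψ x ^ 6 * (∑ k, j x k * v x k) + 3 * α x * ψ x ^ 6 * P x
          + (1 / (2 * π)) * (∑ i, pd i (chi α ψ) x * pd i ψ x)
          - (1 / 2) * ψ x ^ 6 * (∑ k, j x k * β x k))
        + (3 / 4) * (∑ l, pd l (fun y => ψ y ^ 6 * ∑ i, Khat α β i l y * β y i) x) := by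
    intro x
    have ha := (hα x).ne'
    rw [hd1, hd2, hcm, hF1, hham, hslice]
    have hS : ∑ k, j x k * (v x k + β x k) = ∑ k, j x k * v x k + ∑ k, j x k * β x k := by
      rw [← Finset.sum_add_distrib]; exact Finset.sum_congr rfl fun k _ => by ring
    rw [hS]
    generalize (∑ i, pd i (chi α ψ) x * pd i ψ x) = f4
    generalize (∑ k, j x k * β x k) = f2
    generalize (∑ k, j x k * v x k) = f3
    simp only [chi]
    field_simp
    ring
  have hI := integral_add iA iB
  rw [zA, zB] at hI
  simp only [hsum] at hI
  rw [integral_add (hint1.const_mul _) (hint9.const_mul _), integral_const_mul, integral_const_mul,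
    I0, z1] at hI
  have : 2 * π * (Mχ - MADM) = 0 := by linear_combination -hI
  have h2 : Mχ - MADM = 0 := by
    rcases mul_eq_zero.1 this with h | h
    · linarith
    · exact h
  linarith
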